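/- Let K be a field of arbitrary characteristic, A a central line arrangement in K² with |A| = n, and m a multiplicity on A. Put exp(A,m) = (d₁,d₂) with d₁ ≤ d₂. Let α, β ∈ ℝ with α < β and |m| = α + β. If α < n − 1 < β, then α < d₁ ≤ d₂ < β. -/

import Mathlib

open MvPolynomial

variable {K : Type*} [Field K]

/-- A subset of `K × K` is a line through the origin. -/
def IsCentralLine (L : Set (K × K)) : Prop :=
  ∃ a b : K, (a, b) ≠ (0, 0) ∧ L = {p : K × K | a * p.1 + b * p.2 = 0}

/-- A central line arrangement: a finite set of lines through the origin of `K²`. -/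
def IsCentralArr (A : Finset (Set (K × K))) : Prop :=
  ∀ L ∈ A, IsCentralLine L

/-- The linear form `a·x + b·y` in `K[x,y]`. -/
noncomputable def lin2 (a b : K) : MvPolynomial (Fin 2) K :=
  C a * X 0 + C b * X 1

/-- The action on `f` of the derivation with coefficient vector `θ`. -/
noncomputable def applyDer2 (θ : Fin 2 → MvPolynomial (Fin 2) K)
    (f : MvPolynomial (Fin 2) K) : MvPolynomial (Fin 2) K :=
  ∑ i, θ i * pderiv i f

/-- `θ` belongs to `D(A,m)`, the logarithmic derivation module of the multiarrangement
`(A, m)`: `θ(α_H) ∈ S'·α_H^{m(H)}` for every `H ∈ A`. -/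
def InDm (A : Finset (Set (K × K))) (m : Set (K × K) → ℕ)
    (θ : Fin 2 → MvPolynomial (Fin 2) K) : Prop :=
  ∀ L ∈ A, ∀ a b : K, (a, b) ≠ (0, 0) →
    L = {p : K × K | a * p.1 + b * p.2 = 0} →
    ∃ g, applyDer2 θ (lin2 a b) = g * lin2 a b ^ m L

/-- A homogeneous derivation of degree `d` on `K[x,y]`. -/
def HomogDer2 (θ : Fin 2 → MvPolynomial (Fin 2) K) (d : ℕ) : Prop :=
  ∀ i, (θ i).IsHomogeneous d

/-- `exp(A,m) = (d₁,d₂)`: the free module `D(A,m)` has a homogeneous basis with degrees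
`d₁` and `d₂`. -/
def IsExpPair (A : Finset (Set (K × K))) (m : Set (K × K) → ℕ) (d₁ d₂ : ℕ) : Prop :=
  ∃ θ₁ θ₂ : Fin 2 → MvPolynomial (Fin 2) K,
    InDm A m θ₁ ∧ InDm A m θ₂ ∧ HomogDer2 θ₁ d₁ ∧ HomogDer2 θ₂ d₂ ∧
    ∀ θ : Fin 2 → MvPolynomial (Fin 2) K, InDm A m θ →
      ∃! cfs : MvPolynomial (Fin 2) K × MvPolynomial (Fin 2) K,
        θ = fun j => cfs.1 * θ₁ j + cfs.2 * θ₂ j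

/-- `|m| = ∑_{H ∈ A} m(H)`. -/
def msize (A : Finset (Set (K × K))) (m : Set (K × K) → ℕ) : ℕ := ∑ H ∈ A, m H

/-- Linear forms are homogeneous of degree one. -/
lemma isHomogeneous_lin2 {K : Type*} [Field K] (a b : K) : (lin2 a b).IsHomogeneous 1 :=
  (isHomogeneous_C_mul_X a 0).add (isHomogeneous_C_mul_X b 1)

lemma eval_lin2 {K : Type*} [Field K] (a b : K) (v : Fin 2 → K) :
    eval v (lin2 a b) = a * v 0 + b * v 1 := by
  simp [lin2]

lemma applyDer2_lin2 {K : Type*} [Field K] (θ : Fin 2 → MvPolynomial (Fin 2) K) (a b : K) :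
    applyDer2 θ (lin2 a b) = C a * θ 0 + C b * θ 1 := by
  simp [applyDer2, lin2, Fin.sum_univ_two, pderiv_X, mul_comm]

lemma lin2_ne_zero {K : Type*} [Field K] {a b : K} (hab : (a, b) ≠ (0, 0)) : lin2 a b ≠ 0 := by
  intro h
  apply hab
  have h0 := eval_lin2 a b ![1, 0]
  have h1 := eval_lin2 a b ![0, 1]
  rw [h] at h0 h1
  simp only [map_zero, Matrix.cons_val_zero, Matrix.cons_val_one, mul_one, mul_zero, add_zero,
    zero_add] at h0 h1
  rw [← h0, ← h1]

lemma prime_lin2 {K : Type*} [Field K] {a b : K} (hab : (a, b) ≠ (0, 0)) :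
    Prime (lin2 a b) := by
  have h0 := lin2_ne_zero hab
  refine (irreducible_of_totalDegree_eq_one ((isHomogeneous_lin2 a b).totalDegree h0) ?_).prime
  intro x hx
  rw [isUnit_iff_ne_zero]
  rintro rfl
  refine h0 (MvPolynomial.ext _ _ fun i => ?_)
  simpa using hx i

/-- A linear form dividing another one has the same zero line. -/
lemma mul_eq_mul_of_lin2_dvd {K : Type*} [Field K] {a b a' b' : K}
    (h : lin2 a b ∣ lin2 a' b') : a' * b = a * b' := by
  obtain ⟨g, hg⟩ := h
  have := congrArg (eval ![b, -a]) hg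
  simp only [eval_mul, eval_lin2] at this
  simp at this
  linear_combination this + g.eval ![b, -a] * mul_comm a b

lemma exists_smul_of_mul_eq_mul {K : Type*} [Field K] {a b a' b' : K}
    (hab : (a, b) ≠ (0, 0)) (hab' : (a', b') ≠ (0, 0)) (h : a' * b = a * b') :
    ∃ c : K, c ≠ 0 ∧ a' = c * a ∧ b' = c * b := by
  have key : ∃ c : K, a' = c * a ∧ b' = c * b := by
    by_cases ha : a = 0
    · have hb : b ≠ 0 := by rintro rfl; exact hab (by rw [ha])
      refine ⟨b' / b, ?_, by field_simp⟩
      field_simp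
      linear_combination h
    · refine ⟨a' / a, by field_simp, ?_⟩
      field_simp
      linear_combination -h
  obtain ⟨c, rfl, rfl⟩ := key
  refine ⟨c, ?_, rfl, rfl⟩
  rintro rfl
  simp at hab'

lemma mul_eq_mul_of_line_eq {K : Type*} [Field K] {a b a' b' : K}
    (h : {p : K × K | a * p.1 + b * p.2 = 0} = {p : K × K | a' * p.1 + b' * p.2 = 0}) :
    a' * b = a * b' := by
  have : (b, -a) ∈ {p : K × K | a * p.1 + b * p.2 = 0} := by
    simp [mul_comm]
  rw [h] at this
  simp only [Set.mem_ofPred_eq] at this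
  linear_combination this

/-- Chosen defining forms `a L · x + b L · y` for the lines of `A`. -/
def DefiningForms {K : Type*} [Field K] (A : Finset (Set (K × K)))
    (a b : Set (K × K) → K) : Prop :=
  ∀ L ∈ A, (a L, b L) ≠ (0, 0) ∧ L = {p : K × K | a L * p.1 + b L * p.2 = 0}

lemma DefiningForms.not_dvd {K : Type*} [Field K] {A : Finset (Set (K × K))}
    {a b : Set (K × K) → K} (h : DefiningForms A a b) {L M : Set (K × K)}
    (hL : L ∈ A) (hM : M ∈ A) (hne : L ≠ M) : ¬ lin2 (a L) (b L) ∣ lin2 (a M) (b M) := by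
  intro hdvd
  apply hne
  obtain ⟨c, hc, h1, h2⟩ := exists_smul_of_mul_eq_mul (h L hL).1 (h M hM).1
    (mul_eq_mul_of_lin2_dvd hdvd)
  rw [(h L hL).2, (h M hM).2]
  ext p
  simp only [Set.mem_ofPred_eq, h1, h2]
  rw [show c * a L * p.1 + c * b L * p.2 = c * (a L * p.1 + b L * p.2) by ring]
  simp [hc]

lemma DefiningForms.inDm_iff {K : Type*} [Field K] {A : Finset (Set (K × K))}
    {a b : Set (K × K) → K} (h : DefiningForms A a b) (m : Set (K × K) → ℕ)
    (θ : Fin 2 → MvPolynomial (Fin 2) K) :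
    InDm A m θ ↔ ∀ L ∈ A, lin2 (a L) (b L) ^ m L ∣ C (a L) * θ 0 + C (b L) * θ 1 := by
  constructor
  · intro hθ L hL
    obtain ⟨g, hg⟩ := hθ L hL _ _ (h L hL).1 (h L hL).2
    rw [applyDer2_lin2] at hg
    exact ⟨g, by rw [hg, mul_comm]⟩
  · intro hθ L hL a' b' hab' hL'
    obtain ⟨c, hc, rfl, rfl⟩ := exists_smul_of_mul_eq_mul (h L hL).1 hab'
      (mul_eq_mul_of_line_eq ((h L hL).2.symm.trans hL'))
    obtain ⟨g, hg⟩ := hθ L hL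
    refine ⟨C c * C (c⁻¹ ^ m L) * g, ?_⟩
    have hlin : lin2 (c * a L) (c * b L) = C c * lin2 (a L) (b L) := by
      simp only [lin2, C_mul]; ring
    have hinv : C (c⁻¹ ^ m L) * (C c : MvPolynomial (Fin 2) K) ^ m L = 1 := by
      rw [← C_pow, ← C_mul, ← mul_pow, inv_mul_cancel₀ hc, one_pow, C_1]
    rw [applyDer2_lin2, hlin, mul_pow, C_mul, C_mul]
    linear_combination C c * hg - C c * g * lin2 (a L) (b L) ^ m L * hinv

/-- The defining polynomial `∏ α_H ^ m(H)` of a multiarrangement. -/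
noncomputable def defPoly {K : Type*} [Field K] (A : Finset (Set (K × K)))
    (a b : Set (K × K) → K) (m : Set (K × K) → ℕ) : MvPolynomial (Fin 2) K :=
  ∏ L ∈ A, lin2 (a L) (b L) ^ m L

lemma isHomogeneous_defPoly {K : Type*} [Field K] (A : Finset (Set (K × K)))
    (a b : Set (K × K) → K) (m : Set (K × K) → ℕ) :
    (defPoly A a b m).IsHomogeneous (∑ L ∈ A, m L) := by
  refine IsHomogeneous.prod _ _ _ fun L _ => ?_
  simpa using (isHomogeneous_lin2 (a L) (b L)).pow (m L)

namespace DefiningForms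

variable {K : Type*} [Field K] {A : Finset (Set (K × K))} {a b : Set (K × K) → K}

lemma defPoly_ne_zero (h : DefiningForms A a b) (m : Set (K × K) → ℕ) :
    defPoly A a b m ≠ 0 :=
  Finset.prod_ne_zero_iff.2 fun L hL => pow_ne_zero _ (lin2_ne_zero (h L hL).1)

lemma defPoly_dvd (h : DefiningForms A a b) {m : Set (K × K) → ℕ}
    {f : MvPolynomial (Fin 2) K} (hf : ∀ L ∈ A, lin2 (a L) (b L) ^ m L ∣ f) :
    defPoly A a b m ∣ f := by
  refine Finset.prod_dvd_of_isRelPrime (fun L hL M hM hne => ?_) hf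
  refine IsRelPrime.pow ?_
  exact (prime_lin2 (h L hL).1).irreducible.isRelPrime_iff_not_dvd.2 (h.not_dvd hL hM hne)

/-- The products `∏_{M ≠ L} α_M ^ m(M)` have only units as common divisors. -/
lemma isUnit_of_dvd_defPoly_erase [DecidableEq (Set (K × K))] (h : DefiningForms A a b)
    {m : Set (K × K) → ℕ} {g : MvPolynomial (Fin 2) K} (hg : g ∣ defPoly A a b m)
    (hg' : ∀ L ∈ A, g ∣ defPoly (A.erase L) a b m) : IsUnit g := by
  by_contra hu
  have hg0 : g ≠ 0 := ne_zero_of_dvd_ne_zero (h.defPoly_ne_zero m) hg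
  obtain ⟨p, hp, hpg⟩ := WfDvdMonoid.exists_irreducible_factor hu hg0
  obtain ⟨L, hL, hpL⟩ := hp.prime.exists_mem_finset_dvd (hpg.trans hg)
  have hLp : lin2 (a L) (b L) ∣ p :=
    ((hp.dvd_irreducible_iff_associated (prime_lin2 (h L hL).1).irreducible).1
      (hp.prime.dvd_of_dvd_pow hpL)).symm.dvd
  obtain ⟨M, hM, hLM⟩ := (prime_lin2 (h L hL).1).exists_mem_finset_dvd
    (hLp.trans (hpg.trans (hg' L hL)))
  rw [Finset.mem_erase] at hM
  exact h.not_dvd hL hM.2 (Ne.symm hM.1) ((prime_lin2 (h L hL).1).dvd_of_dvd_pow hLM)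

end DefiningForms

/-- The determinant of the coefficient matrix of two derivations. -/
def derDet {R : Type*} [CommRing R] (θ η : Fin 2 → R) : R := θ 0 * η 1 - θ 1 * η 0

lemma dvd_derDet {K : Type*} [Field K] {a b : K} (hab : (a, b) ≠ (0, 0))
    {f : MvPolynomial (Fin 2) K} {θ η : Fin 2 → MvPolynomial (Fin 2) K}
    (hθ : f ∣ C a * θ 0 + C b * θ 1) (hη : f ∣ C a * η 0 + C b * η 1) :
    f ∣ derDet θ η := by
  obtain ⟨g, hg⟩ := hθ
  obtain ⟨k, hk⟩ := hη
  by_cases ha : a = 0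
  · have hb : b ≠ 0 := by rintro rfl; exact hab (by rw [ha])
    have hinv : C b⁻¹ * (C b : MvPolynomial (Fin 2) K) = 1 := by
      rw [← C_mul, inv_mul_cancel₀ hb, C_1]
    refine ⟨C b⁻¹ * (θ 0 * k - η 0 * g), ?_⟩
    unfold derDet
    linear_combination C b⁻¹ * (θ 0 * hk - η 0 * hg) - (θ 0 * η 1 - θ 1 * η 0) * hinv
  · have hinv : C a⁻¹ * (C a : MvPolynomial (Fin 2) K) = 1 := by
      rw [← C_mul, inv_mul_cancel₀ ha, C_1]
    refine ⟨C a⁻¹ * (g * η 1 - k * θ 1), ?_⟩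
    unfold derDet
    linear_combination C a⁻¹ * (η 1 * hg - θ 1 * hk) - (θ 0 * η 1 - θ 1 * η 0) * hinv

/-- Saito's criterion: the determinant of a pair of generators of `D(A,m)` is the defining
polynomial up to a unit. -/
lemma associated_defPoly_derDet {K : Type*} [Field K] {A : Finset (Set (K × K))}
    {a b : Set (K × K) → K} (h : DefiningForms A a b) {m : Set (K × K) → ℕ}
    {θ₁ θ₂ : Fin 2 → MvPolynomial (Fin 2) K} (h₁ : InDm A m θ₁) (h₂ : InDm A m θ₂)
    (hspan : ∀ θ, InDm A m θ → ∃ u v, ∀ j, θ j = u * θ₁ j + v * θ₂ j) :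
    Associated (defPoly A a b m) (derDet θ₁ θ₂) := by
  classical
  have hdet : ∀ η ζ, InDm A m η → InDm A m ζ → derDet θ₁ θ₂ ∣ derDet η ζ := by
    intro η ζ hη hζ
    obtain ⟨u, v, huv⟩ := hspan η hη
    obtain ⟨s, t, hst⟩ := hspan ζ hζ
    refine ⟨u * t - v * s, ?_⟩
    simp only [derDet, huv, hst]
    ring
  have hQmem : ∀ c d, InDm A m ![defPoly A a b m * C c, defPoly A a b m * C d] := by
    intro c d
    rw [h.inDm_iff]
    intro L hL
    have hdvd : lin2 (a L) (b L) ^ m L ∣ defPoly A a b m :=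
      Finset.dvd_prod_of_mem (fun L => lin2 (a L) (b L) ^ m L) hL
    refine hdvd.trans ⟨C (a L) * C c + C (b L) * C d, ?_⟩
    simp
    ring
  have hQ0 := h.defPoly_ne_zero m
  rw [h.inDm_iff] at h₁ h₂
  obtain ⟨g, hg⟩ := h.defPoly_dvd fun L hL => dvd_derDet (h L hL).1 (h₁ L hL) (h₂ L hL)
  suffices IsUnit g from ⟨this.unit, by simp [hg]⟩
  refine h.isUnit_of_dvd_defPoly_erase (m := m) ?_ fun L hL => ?_
  · have := hdet _ _ (hQmem 1 0) (hQmem 0 1)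
    rw [hg] at this
    simpa [derDet, mul_dvd_mul_iff_left hQ0] using this
  · set Q' := defPoly (A.erase L) a b m
    obtain ⟨c, d, hcd⟩ : ∃ c d : K, a L * c + b L * d = 1 := by
      by_cases ha : a L = 0
      · have hb : b L ≠ 0 := fun hb => (h L hL).1 (by rw [ha, hb])
        exact ⟨0, (b L)⁻¹, by simp [hb]⟩
      · exact ⟨(a L)⁻¹, 0, by simp [ha]⟩
    have hmem : InDm A m ![Q' * C (b L), -(Q' * C (a L))] := by
      rw [h.inDm_iff]
      intro M hM
      by_cases hML : M = L
      · subst hML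
        convert dvd_zero _ using 1
        simp
        ring
      · have hdvd : lin2 (a M) (b M) ^ m M ∣ Q' :=
          Finset.dvd_prod_of_mem (fun L => lin2 (a L) (b L) ^ m L)
            (Finset.mem_erase.2 ⟨hML, hM⟩)
        refine hdvd.trans ⟨C (a M) * C (b L) - C (b M) * C (a L), ?_⟩
        simp
        ring
    have := hdet _ _ hmem (hQmem c d)
    have hcd' : C (a L) * C c + C (b L) * C d = (1 : MvPolynomial (Fin 2) K) := by
      rw [← C_mul, ← C_mul, ← C_add, hcd, C_1]
    have hval : derDet ![Q' * C (b L), -(Q' * C (a L))]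
        ![defPoly A a b m * C c, defPoly A a b m * C d] = defPoly A a b m * Q' := by
      simp only [derDet, Matrix.cons_val_zero, Matrix.cons_val_one]
      linear_combination defPoly A a b m * Q' * hcd'
    rwa [hval, hg, mul_dvd_mul_iff_left hQ0] at this

/-- A derivation whose determinant with the Euler derivation vanishes is a multiple of it. -/
lemma exists_eq_mul_X_of_derDet_eq_zero {K : Type*} [Field K]
    {θ : Fin 2 → MvPolynomial (Fin 2) K} (h : derDet X θ = 0) :
    ∃ f, ∀ j, θ j = f * X j := by
  have hX : Prime (X 0 : MvPolynomial (Fin 2) K) := by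
    simpa [lin2] using prime_lin2 (a := (1 : K)) (b := 0) (by simp)
  have h' : (X 0 : MvPolynomial (Fin 2) K) * θ 1 = X 1 * θ 0 := sub_eq_zero.1 h
  obtain ⟨f, hf⟩ : X 0 ∣ θ 0 :=
    (hX.dvd_or_dvd (h' ▸ dvd_mul_right _ _)).resolve_left (by simp [X_dvd_X])
  refine ⟨f, fun j => ?_⟩
  fin_cases j
  · simp [hf, mul_comm]
  · refine mul_left_cancel₀ hX.ne_zero ?_
    simp only [Fin.mk_one]
    rw [h', hf]
    ring

/-- The exponents add up to `|m|`, and either the first exponent is at least `|m| - n + 1` or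
the second one is at most `|m| - n + 1`. -/
lemma exponents_add_and_dichotomy {K : Type*} [Field K] {A : Finset (Set (K × K))}
    (hA : IsCentralArr A) {m : Set (K × K) → ℕ} (hm : ∀ H ∈ A, 1 ≤ m H) {d₁ d₂ : ℕ}
    (hexp : IsExpPair A m d₁ d₂) :
    d₁ + d₂ = msize A m ∧
      (msize A m + 1 ≤ d₁ + A.card ∨ d₂ + A.card ≤ msize A m + 1) := by
  obtain ⟨θ₁, θ₂, h₁, h₂, hd₁, hd₂, hbasis⟩ := hexp
  have hspan : ∀ θ, InDm A m θ → ∃ u v, ∀ j, θ j = u * θ₁ j + v * θ₂ j := by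
    intro θ hθ
    obtain ⟨⟨u, v⟩, huv, -⟩ := hbasis θ hθ
    exact ⟨u, v, fun j => congrFun huv j⟩
  choose! a b hab using hA
  have h : DefiningForms A a b := hab
  have hassoc := associated_defPoly_derDet h h₁ h₂ hspan
  have hdet0 : derDet θ₁ θ₂ ≠ 0 := fun h0 =>
    h.defPoly_ne_zero m (by rwa [h0, associated_zero_iff_eq_zero] at hassoc)
  have hdeth : (derDet θ₁ θ₂).IsHomogeneous (d₁ + d₂) :=
    ((hd₁ 0).mul (hd₂ 1)).sub ((hd₁ 1).mul (hd₂ 0))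
  have hsum : d₁ + d₂ = msize A m := by
    rw [← hdeth.totalDegree hdet0]
    refine le_antisymm ?_ ?_
    · exact (totalDegree_le_of_dvd_of_isDomain hassoc.symm.dvd (h.defPoly_ne_zero m)).trans
        (isHomogeneous_defPoly A a b m).totalDegree_le
    · exact ((isHomogeneous_defPoly A a b m).totalDegree (h.defPoly_ne_zero m)).ge.trans
        (totalDegree_le_of_dvd_of_isDomain hassoc.dvd hdet0)
  refine ⟨hsum, ?_⟩
  set m' : Set (K × K) → ℕ := fun L => m L - 1
  have hcard : ∑ L ∈ A, m' L + A.card = msize A m := by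
    rw [Finset.card_eq_sum_ones, ← Finset.sum_add_distrib]
    exact Finset.sum_congr rfl fun L hL => Nat.sub_add_cancel (hm L hL)
  have hpow : ∀ L ∈ A, lin2 (a L) (b L) ^ m L = lin2 (a L) (b L) ^ m' L * lin2 (a L) (b L) :=
    fun L hL => by rw [← pow_succ, Nat.sub_add_cancel (hm L hL)]
  have hQ0 := h.defPoly_ne_zero m'
  have hQh := isHomogeneous_defPoly A a b m'
  have hmem : InDm A m fun j => defPoly A a b m' * X j := by
    rw [h.inDm_iff]
    intro L hL
    have hdvd : lin2 (a L) (b L) ^ m' L ∣ defPoly A a b m' :=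
      Finset.dvd_prod_of_mem (fun L => lin2 (a L) (b L) ^ m' L) hL
    rw [hpow L hL]
    convert mul_dvd_mul_right hdvd (lin2 (a L) (b L)) using 1
    simp only [lin2]
    ring
  obtain ⟨u, v, huv⟩ := hspan _ hmem
  have hv : defPoly A a b m' * derDet X θ₁ = -(v * derDet θ₁ θ₂) := by
    unfold derDet
    linear_combination θ₁ 1 * huv 0 - θ₁ 0 * huv 1
  by_cases hE : derDet X θ₁ = 0
  · left
    obtain ⟨f, hf⟩ := exists_eq_mul_X_of_derDet_eq_zero hE
    have hf0 : f ≠ 0 := by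
      rintro rfl
      exact hdet0 (by simp [derDet, hf])
    have hQf : defPoly A a b m' ∣ f := by
      refine h.defPoly_dvd fun L hL => ?_
      have := (h.inDm_iff m θ₁).1 h₁ L hL
      rw [hpow L hL, hf, hf,
        show C (a L) * (f * X 0) + C (b L) * (f * X 1) = f * lin2 (a L) (b L) by
          simp only [lin2]; ring] at this
      exact (mul_dvd_mul_iff_right (lin2_ne_zero (h L hL).1)).1 this
    have hle := totalDegree_le_of_dvd_of_isDomain hQf hf0
    rw [hQh.totalDegree hQ0] at hle
    have hX0 : (X 0 : MvPolynomial (Fin 2) K) ≠ 0 := X_ne_zero 0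
    have hdeg := (hd₁ 0).totalDegree (by rw [hf]; exact mul_ne_zero hf0 hX0)
    rw [hf, totalDegree_mul_of_isDomain hf0 hX0, totalDegree_X] at hdeg
    omega
  · right
    have hle := totalDegree_le_of_dvd_of_isDomain
      (Dvd.intro_left (-v) (by rw [hv]; ring) : derDet θ₁ θ₂ ∣ defPoly A a b m' * derDet X θ₁)
      (mul_ne_zero hQ0 hE)
    have hEh : (derDet X θ₁).IsHomogeneous (1 + d₁) :=
      ((isHomogeneous_X K 0).mul (hd₁ 1)).sub ((isHomogeneous_X K 1).mul (hd₁ 0))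
    rw [hdeth.totalDegree hdet0] at hle
    have := hle.trans (hQh.mul hEh).totalDegree_le
    omega

/-- **Lemma 2.8 (3)**. Let `A` be a central line arrangement with `|A| = n` and `m` a
multiplicity with `exp(A,m) = (d₁,d₂)`, `d₁ ≤ d₂`. If `|m| = α + β` with `α < β` real and
`α < n − 1 < β`, then `α < d₁ ≤ d₂ < β`. -/
theorem exponents_strictly_between
    {K : Type*} [Field K] (A : Finset (Set (K × K))) (hA : IsCentralArr A)
    (n : ℕ) (hn : A.card = n)
    (m : Set (K × K) → ℕ) (hm : ∀ H ∈ A, 1 ≤ m H)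
    (d₁ d₂ : ℕ) (hd : d₁ ≤ d₂) (hexp : IsExpPair A m d₁ d₂)
    (α β : ℝ) (hαβ : α < β) (hsum : (msize A m : ℝ) = α + β)
    (hα : α < (n : ℝ) - 1) (hβ : (n : ℝ) - 1 < β) :
    α < (d₁ : ℝ) ∧ (d₂ : ℝ) < β := by
  obtain ⟨hadd, hor⟩ := exponents_add_and_dichotomy hA hm hexp
  have hadd' : (d₁ : ℝ) + d₂ = α + β := by rw [← hsum, ← hadd]; push_cast; rfl
  have hd' : (d₁ : ℝ) ≤ d₂ := by exact_mod_cast hd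
  rw [hn] at hor
  rcases hor with hle | hle
  · have hle' : (msize A m : ℝ) + 1 ≤ d₁ + n := by exact_mod_cast hle
    constructor <;> linarith
  · have hle' : (d₂ : ℝ) + n ≤ msize A m + 1 := by exact_mod_cast hle
    constructor <;> linarith
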